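/- In ℂ[x,y], let i be the imaginary unit and s = √42 (the positive real square root of 42), and define f2 = (14/9)y^2 + (2/27)i y^2 s + xy - (5/9)y - (2/27)i y s - (1/9)x^2 + (1/9)x, g2 = y^2, and h2 = -(23/12)y^2 - (5/9)i y^2 s - 7xy - (2/3)i xy s + (1/6)y + (8/9)i y s - (11/3)x^2 + (11/3)x + (2/3)i x s + 3/4 - (1/3)i s. Let g = f2^3 + g2 * h2. Then g is irreducible in ℂ[x,y], and there do not exist polynomials p, q ∈ ℂ[x,y] with total degree of p at most 2 and total degree of q at most 3 such that g = p^3 + q^2. -/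

import Mathlib

open MvPolynomial

noncomputable section

def x : MvPolynomial (Fin 2) ℂ := X 0
def y : MvPolynomial (Fin 2) ℂ := X 1
def c (q : ℚ) : MvPolynomial (Fin 2) ℂ := C (q : ℂ)

/-- The imaginary unit, as a constant polynomial. -/
def i : MvPolynomial (Fin 2) ℂ := C Complex.I
/-- `s = √42`, as a constant polynomial. -/
def s : MvPolynomial (Fin 2) ℂ := C ((Real.sqrt 42 : ℝ) : ℂ)

def f2 : MvPolynomial (Fin 2) ℂ :=
  c (14/9) * y ^ 2 + c (2/27) * i * y ^ 2 * s + x * y - c (5/9) * y - c (2/27) * i * y * s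
    - c (1/9) * x ^ 2 + c (1/9) * x

def g2 : MvPolynomial (Fin 2) ℂ := y ^ 2

def h2 : MvPolynomial (Fin 2) ℂ :=
  - c (23/12) * y ^ 2 - c (5/9) * i * y ^ 2 * s - 7 * x * y - c (2/3) * i * x * y * s
    + c (1/6) * y + c (8/9) * i * y * s - c (11/3) * x ^ 2 + c (11/3) * x
    + c (2/3) * i * x * s + c (3/4) - c (1/3) * i * s

/-- The sextic of semi-torus type with configuration `[2E_6 + 2A_2]`. -/
def g : MvPolynomial (Fin 2) ℂ := f2 ^ 3 + g2 * h2

abbrev PP := Polynomial (Polynomial ℂ)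

def phi : MvPolynomial (Fin 2) ℂ →ₐ[ℂ] PP :=
  aeval ![Polynomial.C Polynomial.X, Polynomial.X]

lemma phi_coeff_zero (u : MvPolynomial (Fin 2) ℂ) (n : ℕ) (hn : u.totalDegree ≤ n) (k j : ℕ)
    (h : n < j + k) : ((phi u).coeff k).coeff j = 0 := by
  rw [phi, MvPolynomial.aeval_def, MvPolynomial.eval₂_eq', Polynomial.finsetSum_coeff,
    Polynomial.finsetSum_coeff]
  refine Finset.sum_eq_zero fun d hd => ?_
  have h1 := MvPolynomial.le_totalDegree hd
  rw [Finsupp.sum_fintype _ _ (by simp)] at h1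
  simp only [Fin.sum_univ_two, Fin.prod_univ_two] at h1 ⊢
  simp only [Matrix.cons_val_zero, Matrix.cons_val_one, Polynomial.algebraMap_apply]
  rw [← Polynomial.C_pow, ← mul_assoc, ← Polynomial.C_mul, Polynomial.coeff_C_mul,
    Polynomial.coeff_X_pow]
  split_ifs with hk
  · simp only [mul_one, Polynomial.algebraMap_apply, Algebra.algebraMap_self, RingHom.id_apply,
      Polynomial.coeff_C_mul, Polynomial.coeff_X_pow]
    rw [if_neg (by omega)]; simp
  · simp

lemma phi_natDegree (u : MvPolynomial (Fin 2) ℂ) (n : ℕ) (hn : u.totalDegree ≤ n) (k : ℕ)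
    : ((phi u).coeff k).natDegree ≤ n - k := by
  rw [Polynomial.natDegree_le_iff_coeff_eq_zero]
  intro j hj
  exact phi_coeff_zero u n hn k j (by omega)

def tt : ℂ := Complex.I * ((Real.sqrt 42 : ℝ) : ℂ)

lemma tt_sq : tt ^ 2 = -42 := by
  have : (((Real.sqrt 42 : ℝ) : ℂ)) ^ 2 = 42 := by
    rw [← Complex.ofReal_pow, Real.sq_sqrt (by norm_num)]; norm_num
  rw [tt, mul_pow, this, Complex.I_sq]; norm_num

def cc (a : ℂ) : PP := Polynomial.C (Polynomial.C a)

lemma phi_x : phi x = Polynomial.C Polynomial.X := by simp [phi, x]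
lemma phi_y : phi y = Polynomial.X := by simp [phi, y]
lemma phi_c (q : ℚ) : phi (c q) = cc q := by
  simp only [phi, c, cc, MvPolynomial.aeval_C]; rfl
lemma phi_is : phi i * phi s = cc tt := by
  rw [← map_mul, i, s, ← MvPolynomial.C_mul]
  simp only [phi, cc, MvPolynomial.aeval_C]; rfl

def F0 : Polynomial ℂ := Polynomial.C (1/9) * (Polynomial.X - Polynomial.X ^ 2)
def F1 : Polynomial ℂ := Polynomial.X - Polynomial.C (5/9 + 2/27 * tt)
def F2 : Polynomial ℂ := Polynomial.C (14/9 + 2/27 * tt)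
def H0 : Polynomial ℂ := Polynomial.C (-11/3) * Polynomial.X ^ 2
  + Polynomial.C (11/3 + 2/3 * tt) * Polynomial.X + Polynomial.C (3/4 - 1/3 * tt)
def H1 : Polynomial ℂ := Polynomial.C (-7 - 2/3 * tt) * Polynomial.X
  + Polynomial.C (1/6 + 8/9 * tt)
def H2 : Polynomial ℂ := Polynomial.C (-23/12 - 5/9 * tt)

lemma phi_f2 : phi f2 = Polynomial.C F0 + Polynomial.C F1 * Polynomial.X
    + Polynomial.C F2 * Polynomial.X ^ 2 := by
  have e : f2 = c (14/9) * y ^ 2 + c (2/27) * (i * s) * y ^ 2 + x * y - c (5/9) * y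
    - c (2/27) * (i * s) * y - c (1/9) * x ^ 2 + c (1/9) * x := by rw [f2]; ring
  rw [e]
  simp only [map_add, map_sub, map_mul, map_pow, phi_x, phi_y, phi_c, phi_is, F0, F1, F2, cc]
  push_cast
  ring

lemma phi_h2 : phi h2 = Polynomial.C H0 + Polynomial.C H1 * Polynomial.X
    + Polynomial.C H2 * Polynomial.X ^ 2 := by
  have h7 : (7 : MvPolynomial (Fin 2) ℂ) = c 7 := by
    rw [c, Rat.cast_ofNat]; exact (map_ofNat C 7).symm
  have e : h2 = - c (23/12) * y ^ 2 - c (5/9) * (i * s) * y ^ 2 - c 7 * x * y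
    - c (2/3) * (i * s) * x * y
    + c (1/6) * y + c (8/9) * (i * s) * y - c (11/3) * x ^ 2 + c (11/3) * x
    + c (2/3) * (i * s) * x + c (3/4) - c (1/3) * (i * s) := by rw [h2, h7]; ring
  rw [e]
  simp only [map_add, map_sub, map_mul, map_pow, map_neg, phi_x, phi_y, phi_c, phi_is, H0, H1,
    H2, cc]
  push_cast
  simp only [neg_div, map_neg, map_sub, map_add, map_mul]
  ring

lemma key_expand {R : Type*} [CommRing R] (f0 f1 f2 h0 h1 h2 z : R) :
    (f0 + f1 * z + f2 * z ^ 2) ^ 3 + z ^ 2 * (h0 + h1 * z + h2 * z ^ 2)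
      = f0 ^ 3 + 3 * f0 ^ 2 * f1 * z + (3 * f0 ^ 2 * f2 + 3 * f0 * f1 ^ 2 + h0) * z ^ 2
       + (f1 ^ 3 + 6 * f0 * f1 * f2 + h1 + (3 * f0 * f2 ^ 2 + 3 * f1 ^ 2 * f2 + h2) * z
         + 3 * f1 * f2 ^ 2 * z ^ 2 + f2 ^ 3 * z ^ 3) * z ^ 3 := by ring

lemma phi_g : ∃ R : PP, phi g = Polynomial.C (F0 ^ 3) + Polynomial.C (3 * F0 ^ 2 * F1) * Polynomial.X
    + Polynomial.C (3 * F0 ^ 2 * F2 + 3 * F0 * F1 ^ 2 + H0) * Polynomial.X ^ 2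
    + R * Polynomial.X ^ 3 := by
  have h3 : (Polynomial.C 3 : PP) = 3 := map_ofNat Polynomial.C 3
  have e : phi g = phi f2 ^ 3 + phi y ^ 2 * phi h2 := by
    rw [g, g2, map_add, map_mul, map_pow, map_pow]
  rw [e, phi_f2, phi_h2, phi_y, key_expand]
  simp only [map_add, map_mul, map_pow, h3]
  exact ⟨_, rfl⟩

lemma low_coeff (a b d : Polynomial ℂ) (R : PP) :
    (Polynomial.C a + Polynomial.C b * Polynomial.X + Polynomial.C d * Polynomial.X ^ 2
     + R * Polynomial.X ^ 3).coeff 0 = a ∧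
    (Polynomial.C a + Polynomial.C b * Polynomial.X + Polynomial.C d * Polynomial.X ^ 2
     + R * Polynomial.X ^ 3).coeff 1 = b ∧
    (Polynomial.C a + Polynomial.C b * Polynomial.X + Polynomial.C d * Polynomial.X ^ 2
     + R * Polynomial.X ^ 3).coeff 2 = d := by
  simp only [Polynomial.coeff_add, Polynomial.coeff_C_mul, Polynomial.coeff_mul_X_pow']
  simp [Polynomial.coeff_C, Polynomial.coeff_X]

lemma phi_g0 : (phi g).coeff 0 = F0 ^ 3 := by
  obtain ⟨R, h⟩ := phi_g
  rw [h]; exact (low_coeff _ _ _ _).1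
lemma phi_g1 : (phi g).coeff 1 = 3 * F0 ^ 2 * F1 := by
  obtain ⟨R, h⟩ := phi_g
  rw [h]; exact (low_coeff _ _ _ _).2.1
lemma phi_g2 : (phi g).coeff 2 = 3 * F0 ^ 2 * F2 + 3 * F0 * F1 ^ 2 + H0 := by
  obtain ⟨R, h⟩ := phi_g
  rw [h]; exact (low_coeff _ _ _ _).2.2

lemma coeff2_mul (a b : PP) : (a * b).coeff 2 =
    a.coeff 0 * b.coeff 2 + a.coeff 1 * b.coeff 1 + a.coeff 2 * b.coeff 0 := by
  rw [Polynomial.coeff_mul, Finset.Nat.sum_antidiagonal_eq_sum_range_succ_mk]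
  simp [Finset.sum_range_succ]
lemma coeff1_mul (a b : PP) : (a * b).coeff 1 =
    a.coeff 0 * b.coeff 1 + a.coeff 1 * b.coeff 0 := by
  rw [Polynomial.coeff_mul, Finset.Nat.sum_antidiagonal_eq_sum_range_succ_mk]
  simp [Finset.sum_range_succ]

lemma vanish6 (c0 c1 c2 c3 c4 c5 c6 : ℂ)
    (h : ∀ z : ℂ, c0 + c1 * z + c2 * z ^ 2 + c3 * z ^ 3 + c4 * z ^ 4 + c5 * z ^ 5 + c6 * z ^ 6 = 0) :
    c0 = 0 ∧ c1 = 0 ∧ c2 = 0 ∧ c3 = 0 ∧ c4 = 0 ∧ c5 = 0 ∧ c6 = 0 := by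
  have h0 := h 0
  have h1 := h 1
  have h2 := h (-1)
  have h3 := h 2
  have h4 := h (-2)
  have h5 := h 3
  have h6 := h (-3)
  norm_num at h0 h1 h2 h3 h4 h5 h6
  refine ⟨?_, ?_, ?_, ?_, ?_, ?_, ?_⟩ <;> grind

lemma quad_form (p : Polynomial ℂ) (h : p.natDegree ≤ 2) : ∃ a b d : ℂ,
    p = Polynomial.C a + Polynomial.C b * Polynomial.X + Polynomial.C d * Polynomial.X ^ 2 := by
  refine ⟨p.coeff 0, p.coeff 1, p.coeff 2, ?_⟩
  conv_lhs => rw [p.as_sum_range_C_mul_X_pow' (show p.natDegree < 3 by omega)]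
  simp [Finset.sum_range_succ]
lemma cub_form (p : Polynomial ℂ) (h : p.natDegree ≤ 3) : ∃ a b d e : ℂ,
    p = Polynomial.C a + Polynomial.C b * Polynomial.X + Polynomial.C d * Polynomial.X ^ 2
     + Polynomial.C e * Polynomial.X ^ 3 := by
  refine ⟨p.coeff 0, p.coeff 1, p.coeff 2, p.coeff 3, ?_⟩
  conv_lhs => rw [p.as_sum_range_C_mul_X_pow' (show p.natDegree < 4 by omega)]
  simp [Finset.sum_range_succ]
lemma lin_form (p : Polynomial ℂ) (h : p.natDegree ≤ 1) : ∃ a b : ℂ,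
    p = Polynomial.C a + Polynomial.C b * Polynomial.X := by
  refine ⟨p.coeff 0, p.coeff 1, ?_⟩
  conv_lhs => rw [p.as_sum_range_C_mul_X_pow' (show p.natDegree < 2 by omega)]
  simp [Finset.sum_range_succ]

lemma tdeg_g : g.totalDegree ≤ 6 := by
  have hc : ∀ q, (c q).totalDegree = 0 := fun q => totalDegree_C _
  have hx : x.totalDegree = 1 := totalDegree_X _
  have hy : y.totalDegree = 1 := totalDegree_X _
  have hadd : ∀ (p q : MvPolynomial (Fin 2) ℂ) (n : ℕ), p.totalDegree ≤ n → q.totalDegree ≤ n →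
    (p + q).totalDegree ≤ n := fun p q n h1 h2 => (totalDegree_add p q).trans (max_le h1 h2)
  have hsub : ∀ (p q : MvPolynomial (Fin 2) ℂ) (n : ℕ), p.totalDegree ≤ n → q.totalDegree ≤ n →
    (p - q).totalDegree ≤ n := fun p q n h1 h2 => (totalDegree_sub p q).trans (max_le h1 h2)
  have hmul : ∀ (p q : MvPolynomial (Fin 2) ℂ) (n m k : ℕ), p.totalDegree ≤ n → q.totalDegree ≤ m →
    n + m ≤ k → (p * q).totalDegree ≤ k := fun p q n m k h1 h2 h3 =>
      (totalDegree_mul p q).trans (by omega)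
  have hpow : ∀ (p : MvPolynomial (Fin 2) ℂ) (n m k : ℕ), p.totalDegree ≤ n →
    m * n ≤ k → (p ^ m).totalDegree ≤ k := fun p n m k h1 h3 =>
      (totalDegree_pow p m).trans ((Nat.mul_le_mul_left _ h1).trans h3)
  have hy2 : (y ^ 2).totalDegree ≤ 2 := hpow _ 1 _ _ hy.le (by norm_num)
  have hx2 : (x ^ 2).totalDegree ≤ 2 := hpow _ 1 _ _ hx.le (by norm_num)
  have hxy : (x * y).totalDegree ≤ 2 := hmul _ _ 1 1 2 hx.le hy.le (by norm_num)
  have hyy : y.totalDegree ≤ 2 := by omega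
  have hxx : x.totalDegree ≤ 2 := by omega
  have hk : ∀ (a : ℂ) (p : MvPolynomial (Fin 2) ℂ), p.totalDegree ≤ 2 →
    (C a * p).totalDegree ≤ 2 := fun a p h => hmul _ _ 0 2 2 (totalDegree_C _).le h (by norm_num)
  have h1 : f2.totalDegree ≤ 2 := by
    have e : f2 = C ((14/9 : ℚ) : ℂ) * y ^ 2 + C (((2/27 : ℚ) : ℂ) * Complex.I * ((Real.sqrt 42 : ℝ) : ℂ)) * y ^ 2 + x * y - C ((5/9 : ℚ) : ℂ) * y
      - C (((2/27 : ℚ) : ℂ) * Complex.I * ((Real.sqrt 42 : ℝ) : ℂ)) * y - C ((1/9 : ℚ) : ℂ) * x ^ 2 + C ((1/9 : ℚ) : ℂ) * x := by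
      simp only [f2, c, i, s, C_mul]; ring
    rw [e]
    repeat' first | with_reducible assumption | with_reducible apply hadd | with_reducible apply hsub | with_reducible apply hk
  have h2' : h2.totalDegree ≤ 2 := by
    have h7 : (7 : MvPolynomial (Fin 2) ℂ) = C 7 := (map_ofNat C 7).symm
    have e : h2 = C (-((23/12 : ℚ) : ℂ)) * y ^ 2 - C (((5/9 : ℚ) : ℂ) * Complex.I * ((Real.sqrt 42 : ℝ) : ℂ)) * y ^ 2 - C 7 * (x * y)
       - C (((2/3 : ℚ) : ℂ) * Complex.I * ((Real.sqrt 42 : ℝ) : ℂ)) * (x * y) + C ((1/6 : ℚ) : ℂ) * y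
       + C (((8/9 : ℚ) : ℂ) * Complex.I * ((Real.sqrt 42 : ℝ) : ℂ)) * y - C ((11/3 : ℚ) : ℂ) * x ^ 2 + C ((11/3 : ℚ) : ℂ) * x
       + C (((2/3 : ℚ) : ℂ) * Complex.I * ((Real.sqrt 42 : ℝ) : ℂ)) * x
       + C ((3/4 : ℚ) : ℂ) - C (((1/3 : ℚ) : ℂ) * Complex.I * ((Real.sqrt 42 : ℝ) : ℂ)) := by
      simp only [h2, c, i, s, C_mul, h7, C_neg]; ring
    rw [e]
    have hC : ∀ a : ℂ, (C a : MvPolynomial (Fin 2) ℂ).totalDegree ≤ 2 := fun a => by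
      rw [totalDegree_C]; norm_num
    repeat' first | with_reducible assumption | with_reducible apply hadd | with_reducible apply hsub | with_reducible apply hk | with_reducible apply hC
  rw [g, g2]
  exact hadd _ _ _ (hpow _ 2 _ _ h1 (by norm_num)) (hmul _ _ 2 2 6 hy2 h2' (by norm_num))

lemma cop (B : Polynomial ℂ) (r : ℂ) (hr : B.eval r ≠ 0) :
    IsCoprime B (Polynomial.X - Polynomial.C r) := by
  rw [isCoprime_comm, (Polynomial.irreducible_X_sub_C r).coprime_iff_not_dvd,
    Polynomial.dvd_iff_isRoot]
  exact hr

lemma nt_noncoprime (a1 a2 b0 b1 : ℂ) (e0 : a1 ^ 3 = 1) (e1 : 3 * a1 ^ 2 * a2 + b0 ^ 2 = -3)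
    (e2 : 3 * a1 * a2 ^ 2 + 2 * b0 * b1 = 3) (e3 : a2 ^ 3 + b1 ^ 2 = -1) : b0 = 0 ∧ b1 = 0 := by
  obtain ⟨d, rfl⟩ : ∃ d, a2 = d - a1 := ⟨a2 + a1, by ring⟩
  have f0 : b0 ^ 2 = -3 * a1 ^ 2 * d := by linear_combination e1 + 3 * e0
  have f1 : 2 * b0 * b1 = 6 * a1 ^ 2 * d - 3 * a1 * d ^ 2 := by linear_combination e2 - 3 * e0
  have f2 : b1 ^ 2 = - d ^ 3 + 3 * a1 * d ^ 2 - 3 * a1 ^ 2 * d := by linear_combination e3 + e0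
  have ha : a1 ≠ 0 := by rintro rfl; norm_num at e0
  have h : 3 * a1 ^ 2 * d ^ 4 = 0 := by
    linear_combination (2 * b0 * b1 + (6 * a1 ^ 2 * d - 3 * a1 * d ^ 2)) * f1 - 4 * b1 ^ 2 * f0
      - 4 * (-3 * a1 ^ 2 * d) * f2
  have hd : d = 0 := by simpa [ha] using h
  subst hd
  constructor
  · simpa using f0
  · simpa using f2

/-- one-variable statement, with coefficients -/
lemma nt_zero (a0 a1 a2 b0 b1 b2 b3 : ℂ) (ha : a0 = 0)
    (h : ∀ z : ℂ, (a0 + a1 * z + a2 * z ^ 2) ^ 3 + (b0 + b1 * z + b2 * z ^ 2 + b3 * z ^ 3) ^ 2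
      = (z - z ^ 2) ^ 3) : b0 = 0 ∧ b1 = 0 ∧ b2 = 0 ∧ b3 = 0 := by
  subst ha
  obtain ⟨h0, h1, h2, h3, h4, h5, h6⟩ := vanish6 (b0 ^ 2) (2 * b0 * b1) (2 * b0 * b2 + b1 ^ 2)
    (a1 ^ 3 + 2 * b0 * b3 + 2 * b1 * b2 - 1) (3 * a1 ^ 2 * a2 + b2 ^ 2 + 2 * b1 * b3 + 3)
    (3 * a1 * a2 ^ 2 + 2 * b2 * b3 - 3) (a2 ^ 3 + b3 ^ 2 + 1) (fun z => by
      linear_combination h z)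
  have hb0 : b0 = 0 := by simpa using h0
  subst hb0
  have hb1 : b1 = 0 := by simpa using h2
  subst hb1
  have := nt_noncoprime a1 a2 b2 b3 (by linear_combination h3) (by linear_combination h4)
    (by linear_combination h5) (by linear_combination h6)
  exact ⟨rfl, rfl, this.1, this.2⟩

lemma nt_main (a0 a1 a2 b0 b1 b2 b3 : ℂ)
    (h : ∀ z : ℂ, (a0 + a1 * z + a2 * z ^ 2) ^ 3 + (b0 + b1 * z + b2 * z ^ 2 + b3 * z ^ 3) ^ 2
      = (z - z ^ 2) ^ 3) : b0 = 0 ∧ b1 = 0 ∧ b2 = 0 ∧ b3 = 0 := by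
  by_cases ha0 : a0 = 0
  · exact nt_zero a0 a1 a2 b0 b1 b2 b3 ha0 h
  by_cases ha1 : a0 + a1 + a2 = 0
  · have := nt_zero (a0 + a1 + a2) (-a1 - 2 * a2) a2 (b0 + b1 + b2 + b3) (-b1 - 2 * b2 - 3 * b3)
      (b2 + 3 * b3) (-b3) ha1 (fun z => by linear_combination h (1 - z))
    obtain ⟨k0, k1, k2, k3⟩ := this
    have k3' : b3 = 0 := by linear_combination - k3
    have k2' : b2 = 0 := by linear_combination k2 - 3 * k3'
    have k1' : b1 = 0 := by linear_combination -k1 - 2 * k2' - 3 * k3'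
    exact ⟨by linear_combination k0 - k1' - k2' - k3', k1', k2', k3'⟩
  exfalso
  obtain ⟨h0, h1, h2, h3, h4, h5, h6⟩ := vanish6 (a0 ^ 3 + b0 ^ 2) (3 * a0 ^ 2 * a1 + 2 * b0 * b1)
    (3 * a0 ^ 2 * a2 + 3 * a0 * a1 ^ 2 + 2 * b0 * b2 + b1 ^ 2)
    (a1 ^ 3 + 6 * a0 * a1 * a2 + 2 * b0 * b3 + 2 * b1 * b2 - 1)
    (3 * a0 * a2 ^ 2 + 3 * a1 ^ 2 * a2 + b2 ^ 2 + 2 * b1 * b3 + 3)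
    (3 * a1 * a2 ^ 2 + 2 * b2 * b3 - 3) (a2 ^ 3 + b3 ^ 2 + 1) (fun z => by
      linear_combination h z)
  have g1 := h 1
  -- B divides W
  let B : Polynomial ℂ := Polynomial.C b0 + Polynomial.C b1 * Polynomial.X
    + Polynomial.C b2 * Polynomial.X ^ 2 + Polynomial.C b3 * Polynomial.X ^ 3
  let A : Polynomial ℂ := Polynomial.C a0 + Polynomial.C a1 * Polynomial.X
    + Polynomial.C a2 * Polynomial.X ^ 2
  let W : Polynomial ℂ := Polynomial.C (-a0) + Polynomial.C (2 * a0) * Polynomial.X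
    + Polynomial.C (a1 + a2) * Polynomial.X ^ 2
  let F : Polynomial ℂ := Polynomial.X - Polynomial.X ^ 2
  have hB0 : B.eval 0 ≠ 0 := by
    intro hb
    have : b0 = 0 := by simpa [B] using hb
    rw [this] at h0
    exact ha0 (by simpa using h0)
  have hB1 : B.eval 1 ≠ 0 := by
    intro hb
    have : b0 + b1 + b2 + b3 = 0 := by simpa [B] using hb
    have : (a0 + a1 + a2) ^ 3 = 0 := by
      linear_combination g1 - (b0 + b1 + b2 + b3) * this
    exact ha1 (by simpa using this)
  have hABF : A ^ 3 + B ^ 2 = F ^ 3 := by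
    apply Polynomial.funext
    intro z
    have := h z
    simpa [A, B, F] using this
  have hder := congrArg Polynomial.derivative hABF
  have hWdef : F * Polynomial.derivative A - Polynomial.derivative F * A = W := by
    simp only [A, F, W, map_add, map_sub, Polynomial.derivative_C, Polynomial.derivative_mul,
      Polynomial.derivative_X, Polynomial.derivative_X_pow, map_mul, map_neg]
    have h2 : (Polynomial.C 2 : Polynomial ℂ) = 2 := map_ofNat Polynomial.C 2
    norm_num [h2]
    ring
  have hid : B * (2 * Polynomial.derivative B * A - 3 * B * Polynomial.derivative A)
      = - 3 * F ^ 2 * W := by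
    simp only [map_add, Polynomial.derivative_pow] at hder
    have h2 : (Polynomial.C 2 : Polynomial ℂ) = 2 := map_ofNat Polynomial.C 2
    have h3 : (Polynomial.C 3 : Polynomial ℂ) = 3 := map_ofNat Polynomial.C 3
    norm_num [h2, h3] at hder
    rw [← hWdef]
    clear_value A B F W
    linear_combination A * hder - 3 * Polynomial.derivative A * hABF
  have hdvd : B ∣ W := by
    have c0 := cop B 0 hB0
    have c1 := cop B 1 hB1
    have c2 : IsCoprime B (((Polynomial.X - Polynomial.C 0) * (Polynomial.X - Polynomial.C 1)) ^ 2) :=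
      (c0.mul_right c1).pow_right
    apply c2.dvd_of_dvd_mul_left
    refine ⟨Polynomial.C (-1/3) * (2 * Polynomial.derivative B * A - 3 * B * Polynomial.derivative A), ?_⟩
    have h3 : (Polynomial.C (-1/3) : Polynomial ℂ) * 3 = -1 := by
      rw [← map_ofNat Polynomial.C 3, ← Polynomial.C_mul]; norm_num
    simp only [F] at hid
    simp only [Polynomial.C_0, Polynomial.C_1]
    linear_combination (-Polynomial.C (-1/3)) * hid + (Polynomial.X - Polynomial.X ^ 2) ^ 2 * W * h3
  have hW : W ≠ 0 := by
    intro hw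
    have := congrArg (Polynomial.eval 0) hw
    simp [W] at this
    exact ha0 this
  have hdeg := Polynomial.natDegree_le_of_dvd hdvd hW
  have hWd : W.natDegree ≤ 2 := by
    simp only [W]; compute_degree
  have hBc3 : B.coeff 3 = b3 := by simp [B, Polynomial.coeff_X, Polynomial.coeff_C]
  have hBc2 : B.coeff 2 = b2 := by simp [B, Polynomial.coeff_X, Polynomial.coeff_C]
  have hb3 : b3 = 0 := by
    rw [← hBc3]; exact Polynomial.coeff_eq_zero_of_natDegree_lt (by omega)
  have ha2 : a2 ^ 3 = -1 := by rw [hb3] at h6; linear_combination h6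
  have ha2' : a2 ≠ 0 := by intro h; rw [h] at ha2; norm_num at ha2
  have ha12 : a1 + a2 = 0 := by
    have : a2 ^ 2 * (a1 + a2) = 0 := by
      rw [hb3] at h5
      linear_combination h5 / 3 + ha2
    simpa [ha2'] using this
  have hWd1 : W.natDegree ≤ 1 := by
    simp only [W, ha12, map_zero, zero_mul, add_zero]; compute_degree
  have hb2 : b2 = 0 := by
    rw [← hBc2]; exact Polynomial.coeff_eq_zero_of_natDegree_lt (by omega)
  have : a1 = - a2 := by linear_combination ha12
  subst this
  rw [hb3, hb2] at h4
  have : 3 * a0 * a2 ^ 2 = 0 := by linear_combination h4 - 3 * ha2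
  simp [ha0, ha2'] at this

lemma F0_ne : F0 ≠ 0 := by
  intro h
  have := congrArg (Polynomial.eval 2) h
  norm_num [F0] at this

lemma tt_ne : tt ≠ 0 := by
  intro h; have := tt_sq; rw [h] at this; norm_num at this

lemma nontorus : ¬ ∃ p q : MvPolynomial (Fin 2) ℂ,
        p.totalDegree ≤ 2 ∧ q.totalDegree ≤ 3 ∧ g = p ^ 3 + q ^ 2 := by
  rintro ⟨p, q, hp, hq, hg⟩
  have hphi : phi g = phi p * (phi p * phi p) + phi q * phi q := by
    rw [hg, map_add, map_pow, map_pow]; ring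
  have e0 := phi_g0
  have e1 := phi_g1
  have e2 := phi_g2
  rw [hphi] at e0 e1 e2
  simp only [Polynomial.coeff_add, Polynomial.mul_coeff_zero, coeff1_mul, coeff2_mul] at e0 e1 e2
  have dp0 := phi_natDegree p 2 hp 0
  have dp2 := phi_natDegree p 2 hp 2
  have dq0 := phi_natDegree q 3 hq 0
  have dq1 := phi_natDegree q 3 hq 1
  generalize (phi p).coeff 0 = P0 at *
  generalize (phi p).coeff 1 = P1 at *
  generalize (phi p).coeff 2 = P2 at *
  generalize (phi q).coeff 0 = Q0 at *
  generalize (phi q).coeff 1 = Q1 at *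
  generalize (phi q).coeff 2 = Q2 at *
  have hQ0 : Q0 = 0 := by
    obtain ⟨a0, a1, a2, rfl⟩ := quad_form P0 dp0
    obtain ⟨b0, b1, b2, b3, rfl⟩ := cub_form Q0 dq0
    obtain ⟨k0, k1, k2, k3⟩ := nt_main (9 * a0) (9 * a1) (9 * a2) (27 * b0) (27 * b1) (27 * b2)
      (27 * b3) (fun z => by
        have := congrArg (Polynomial.eval z) e0
        simp [F0] at this
        linear_combination 729 * this)
    have k0 : b0 = 0 := by simpa using k0
    have k1 : b1 = 0 := by simpa using k1
    have k2 : b2 = 0 := by simpa using k2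
    have k3 : b3 = 0 := by simpa using k3
    simp [k0, k1, k2, k3]
  subst hQ0
  have e0' : P0 ^ 3 = F0 ^ 3 := by linear_combination e0
  -- P0 = w F0
  obtain ⟨w, hw, hP0⟩ : ∃ w : ℂ, w ^ 3 = 1 ∧ P0 = Polynomial.C w * F0 := by
    have hd : F0 ∣ P0 := (IsIntegrallyClosed.pow_dvd_pow_iff (n := 3) (by norm_num)).1 ⟨1, by rw [e0']; ring⟩
    obtain ⟨k, hk⟩ := hd
    have hk3 : k ^ 3 = 1 := by
      have : F0 ^ 3 * k ^ 3 = F0 ^ 3 * 1 := by rw [← mul_pow, ← hk, e0']; ring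
      exact mul_left_cancel₀ (pow_ne_zero 3 F0_ne) this
    have hu : IsUnit k := IsUnit.of_pow_eq_one hk3 (by norm_num)
    obtain ⟨w, -, rfl⟩ := Polynomial.isUnit_iff.1 hu
    refine ⟨w, ?_, by rw [hk]; ring⟩
    rw [← Polynomial.C_pow] at hk3
    exact Polynomial.C_injective (by rw [hk3, Polynomial.C_1])
  have hCw : (Polynomial.C w : Polynomial ℂ) ^ 3 = 1 := by
    rw [← Polynomial.C_pow, hw, Polynomial.C_1]
  subst hP0
  generalize hW : (Polynomial.C w : Polynomial ℂ) = W at *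
  have hF := F0_ne
  have e1' : W ^ 2 * P1 = F1 := by
    have : (3 * F0 ^ 2) * (W ^ 2 * P1) = 3 * F0 ^ 2 * F1 := by linear_combination e1
    exact mul_left_cancel₀ (mul_ne_zero (by norm_num) (pow_ne_zero 2 hF)) this
  have hP1 : P1 = W * F1 := by rw [← e1']; linear_combination (-P1) * hCw
  subst hP1
  have e2' : Q1 ^ 2 = H0 + 3 * F0 ^ 2 * (F2 - W ^ 2 * P2) := by
    linear_combination e2 - 3 * F0 * F1 ^ 2 * hCw
  subst hW
  have hP2 := Polynomial.eq_C_of_natDegree_le_zero (by simpa using dp2)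
  obtain ⟨m, rfl⟩ : ∃ m, P2 = Polynomial.C m := ⟨_, hP2⟩
  obtain ⟨γ, β, α, rfl⟩ := quad_form Q1 (by simpa using dq1)
  obtain ⟨κ, hκ⟩ : ∃ κ : ℂ, κ = 14/9 + 2/27 * tt - w ^ 2 * m := ⟨_, rfl⟩
  have hz : ∀ z : ℂ, (γ + β * z + α * z ^ 2) ^ 2 = -11/3 * z ^ 2 + (11/3 + 2/3 * tt) * z
      + (3/4 - 1/3 * tt) + 1/27 * (z - z ^ 2) ^ 2 * κ := by
    intro z
    have := congrArg (Polynomial.eval z) e2'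
    simp [H0, F0, F2] at this
    rw [this, hκ]; ring
  obtain ⟨h0, h1, h2, h3, h4, -, -⟩ := vanish6 (γ ^ 2 - (3/4 - 1/3 * tt))
    (2 * γ * β - (11/3 + 2/3 * tt)) (β ^ 2 + 2 * α * γ + 11/3 - κ / 27) (2 * α * β + 2 * κ / 27)
    (α ^ 2 - κ / 27) 0 0 (fun z => by linear_combination hz z)
  have hab : α * (α + β) = 0 := by linear_combination h4 + h3 / 2
  have hsq := tt_sq
  rcases mul_eq_zero.1 hab with ha | ha
  · subst ha
    have hk : κ = 0 := by linear_combination (-27) * h4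
    subst hk
    have : (52 : ℂ) / 9 = 0 := by
      linear_combination 4 * β ^ 2 * h0 + 4 * (3/4 - 1/3 * tt) * h2
        - (2 * γ * β + (11/3 + 2/3 * tt)) * h1 - 4 / 9 * hsq
    norm_num at this
  · have hb : β = - α := by linear_combination ha
    subst hb
    have : tt = 0 := by linear_combination (-3/2) * (h1 + h2 - h4)
    exact tt_ne this

lemma local_aux (r : ℂ) (a b U1 U2 V1 V2 K L : Polynomial ℂ) (hK : K.eval r ≠ 0)
    (e0 : ((Polynomial.X - Polynomial.C r) * a) * ((Polynomial.X - Polynomial.C r) ^ 2 * b)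
      = (Polynomial.X - Polynomial.C r) ^ 3 * K)
    (e1 : ((Polynomial.X - Polynomial.C r) * a) * V1
      + U1 * ((Polynomial.X - Polynomial.C r) ^ 2 * b) = (Polynomial.X - Polynomial.C r) ^ 2 * L)
    (e2 : (((Polynomial.X - Polynomial.C r) * a) * V2 + U1 * V1
      + U2 * ((Polynomial.X - Polynomial.C r) ^ 2 * b)).eval r ≠ 0) : False := by
  have hne : (Polynomial.X - Polynomial.C r : Polynomial ℂ) ≠ 0 := Polynomial.X_sub_C_ne_zero r
  have h0 : a * b = K := by
    apply mul_left_cancel₀ (pow_ne_zero 3 hne)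
    linear_combination e0
  have h1 : a * V1 = (Polynomial.X - Polynomial.C r) * (L - U1 * b) := by
    apply mul_left_cancel₀ hne
    linear_combination e1
  have ha : a.eval r ≠ 0 := by
    intro h; apply hK; rw [← h0, Polynomial.eval_mul, h, zero_mul]
  have hV : V1.eval r = 0 := by
    have := congrArg (Polynomial.eval r) h1
    simpa [ha] using this
  apply e2
  simp [hV]

lemma local_split (r : ℂ) (U0 U1 U2 V0 V1 V2 K L : Polynomial ℂ) (hK : K.eval r ≠ 0)
    (e0 : U0 * V0 = (Polynomial.X - Polynomial.C r) ^ 3 * K)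
    (e1 : U0 * V1 + U1 * V0 = (Polynomial.X - Polynomial.C r) ^ 2 * L)
    (e2 : (U0 * V2 + U1 * V1 + U2 * V0).eval r ≠ 0) :
    (Polynomial.X - Polynomial.C r) ^ 3 ∣ U0 ∨ (Polynomial.X - Polynomial.C r) ^ 3 ∣ V0 := by
  by_cases hU : U0.eval r = 0
  swap
  · right
    exact (cop U0 r hU).symm.pow_left.dvd_of_dvd_mul_left ⟨K, e0⟩
  by_cases hV : V0.eval r = 0
  swap
  · left
    exact (cop V0 r hV).symm.pow_left.dvd_of_dvd_mul_right ⟨K, e0⟩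
  exfalso
  obtain ⟨a, rfl⟩ := Polynomial.dvd_iff_isRoot.2 hU
  obtain ⟨b, rfl⟩ := Polynomial.dvd_iff_isRoot.2 hV
  have hne : (Polynomial.X - Polynomial.C r : Polynomial ℂ) ≠ 0 := Polynomial.X_sub_C_ne_zero r
  have h0 : a * b = (Polynomial.X - Polynomial.C r) * K := by
    apply mul_left_cancel₀ (pow_ne_zero 2 hne)
    linear_combination e0
  have h1 : a.eval r * b.eval r = 0 := by
    have := congrArg (Polynomial.eval r) h0
    simpa using this
  rcases mul_eq_zero.1 h1 with h | h
  · obtain ⟨a, rfl⟩ := Polynomial.dvd_iff_isRoot.2 h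
    have e2' := e2
    rw [show ∀ t : Polynomial ℂ, t * ((t * a)) * V2 + U1 * V1 + U2 * (t * b)
      = (t * b) * U2 + V1 * U1 + V2 * (t ^ 2 * a) from fun t => by ring] at e2'
    generalize hT : (Polynomial.X - Polynomial.C r : Polynomial ℂ) = T at e0 e1
    refine local_aux r b a V1 V2 U1 U2 K L hK ?_ ?_ e2'
    · rw [hT]; linear_combination e0
    · rw [hT]; linear_combination e1
  · obtain ⟨b, rfl⟩ := Polynomial.dvd_iff_isRoot.2 h
    have e2' := e2
    rw [show ∀ t : Polynomial ℂ, t * a * V2 + U1 * V1 + U2 * (t * (t * b))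
      = (t * a) * V2 + U1 * V1 + U2 * (t ^ 2 * b) from fun t => by ring] at e2'
    generalize hT : (Polynomial.X - Polynomial.C r : Polynomial ℂ) = T at e0 e1
    refine local_aux r a b U1 U2 V1 V2 K L hK ?_ ?_ e2'
    · rw [hT]; linear_combination e0
    · rw [hT]; linear_combination e1

/-- no splitting into two cubics -/
lemma no_cubics (α β a0 a1 a2 b0 b1 b2 u0 u1 v0 v1 : ℂ) (hαβ : α * β = -1/729)
    (h1 : ∀ z : ℂ, α * z ^ 3 * (b0 + b1 * z + b2 * z ^ 2) + (a0 + a1 * z + a2 * z ^ 2) *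
      (β * (z - 1) ^ 3) = 1/27 * (z - z ^ 2) ^ 2 * (z - (5/9 + 2/27 * tt)))
    (h2 : ∀ z : ℂ, α * z ^ 3 * (v0 + v1 * z) + (a0 + a1 * z + a2 * z ^ 2) * (b0 + b1 * z + b2 * z ^ 2)
      + (u0 + u1 * z) * (β * (z - 1) ^ 3) = 1/27 * (z - z ^ 2) ^ 2 * (14/9 + 2/27 * tt)
      + 1/3 * (z - z ^ 2) * (z - (5/9 + 2/27 * tt)) ^ 2
      + (-11/3 * z ^ 2 + (11/3 + 2/3 * tt) * z + (3/4 - 1/3 * tt))) : False := by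
  have hα : α ≠ 0 := by rintro rfl; norm_num at hαβ
  have hβ : β ≠ 0 := by rintro rfl; norm_num at hαβ
  obtain ⟨e, he⟩ : ∃ e : ℂ, e = 5/9 + 2/27 * tt := ⟨_, rfl⟩
  have het : tt = 27/2 * (e - 5/9) := by rw [he]; ring
  rw [← he] at h1
  obtain ⟨k0, k1, k2, k3, k4, k5, -⟩ := vanish6 (-β * a0) (β * (3 * a0 - a1))
    (β * (-3 * a0 + 3 * a1 - a2) + e / 27)
    (α * b0 + β * (a0 - 3 * a1 + 3 * a2) - 1/27 * (1 + 2 * e))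
    (α * b1 + β * (a1 - 3 * a2) + 1/27 * (2 + e)) (α * b2 + β * a2 - 1/27) 0
    (fun z => by linear_combination h1 z)
  have ha0 : a0 = 0 := by simpa [hβ] using k0
  subst ha0
  have ha1 : a1 = 0 := by simpa [hβ] using k1
  subst ha1
  have hA : β * a2 = e / 27 := by linear_combination -k2
  have hB2 : α * b2 = (1 - e) / 27 := by linear_combination k5 - hA
  have hB1 : α * b1 = -2 * (1 - e) / 27 := by linear_combination k4 + 3 * hA
  have hB0 : α * b0 = (1 - e) / 27 := by linear_combination k3 - 3 * hA
  have p2 : a2 * b2 = - e * (1 - e) := by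
    linear_combination (-729) * (β * a2) * hB2 - 27 * (1 - e) * hA + 729 * a2 * b2 * hαβ
  have p1 : a2 * b1 = 2 * e * (1 - e) := by
    linear_combination (-729) * (β * a2) * hB1 + 54 * (1 - e) * hA + 729 * a2 * b1 * hαβ
  have p0 : a2 * b0 = - e * (1 - e) := by
    linear_combination (-729) * (β * a2) * hB0 - 27 * (1 - e) * hA + 729 * a2 * b0 * hαβ
  have d0 := h2 0
  have d1 := h2 1
  have d2 := h2 (-1)
  have d3 := h2 2
  have d4 := h2 (-2)
  have hsq := tt_sq
  rw [← he] at d0 d1 d2 d3 d4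
  rw [het] at d0 d1 d2 d3 d4 hsq
  clear het he k0 k1 k2 k3 k4 k5 hA hB0 hB1 hB2 h1 h2
  obtain ⟨q0, hq0⟩ : ∃ q, q = α * v0 := ⟨_, rfl⟩
  obtain ⟨q1, hq1⟩ : ∃ q, q = α * v1 := ⟨_, rfl⟩
  obtain ⟨r0, hr0⟩ : ∃ q, q = β * u0 := ⟨_, rfl⟩
  obtain ⟨r1, hr1⟩ : ∃ q, q = β * u1 := ⟨_, rfl⟩
  grind

lemma phi_key (u v : MvPolynomial (Fin 2) ℂ) (hg : g = u * v) :
    IsUnit u ∨ IsUnit v := by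
  have hg0 : g ≠ 0 := by
    intro h
    have := phi_g0
    rw [h, map_zero] at this
    exact pow_ne_zero 3 F0_ne (by simpa using this.symm)
  have hu : u ≠ 0 := by rintro rfl; simp at hg; exact hg0 hg
  have hv : v ≠ 0 := by rintro rfl; simp at hg; exact hg0 hg
  have hdeg : u.totalDegree + v.totalDegree ≤ 6 := by
    rw [← totalDegree_mul_of_isDomain hu hv, ← hg]; exact tdeg_g
  have unit_of : ∀ w : MvPolynomial (Fin 2) ℂ, w ≠ 0 → w.totalDegree = 0 → IsUnit w := by
    intro w hw h
    rw [totalDegree_eq_zero_iff_eq_C] at h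
    rw [h] at hw ⊢
    have : coeff 0 w ≠ 0 := by intro h'; rw [h', C_0] at hw; exact hw rfl
    exact this.isUnit.map C
  have hphi : phi g = phi u * phi v := by rw [hg, map_mul]
  have e0 := phi_g0
  have e1 := phi_g1
  have e2 := phi_g2
  rw [hphi] at e0 e1 e2
  rw [Polynomial.mul_coeff_zero] at e0
  rw [coeff1_mul] at e1
  rw [coeff2_mul] at e2
  -- degree control
  have big : ∀ w : MvPolynomial (Fin 2) ℂ, (phi w).coeff 0 ≠ 0 →
      (Polynomial.X - Polynomial.C (0:ℂ)) ^ 3 ∣ (phi w).coeff 0 →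
      (Polynomial.X - Polynomial.C (1:ℂ)) ^ 3 ∣ (phi w).coeff 0 → 6 ≤ w.totalDegree := by
    intro w hw h0 h1
    have hc : IsCoprime ((Polynomial.X - Polynomial.C (0:ℂ)) ^ 3) ((Polynomial.X - Polynomial.C (1:ℂ)) ^ 3) :=
      (Polynomial.isCoprime_X_sub_C_of_isUnit_sub (by norm_num)).pow
    have := Polynomial.natDegree_le_of_dvd (hc.mul_dvd h0 h1) hw
    rw [Polynomial.natDegree_mul (pow_ne_zero _ (Polynomial.X_sub_C_ne_zero _))
      (pow_ne_zero _ (Polynomial.X_sub_C_ne_zero _)), Polynomial.natDegree_pow,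
      Polynomial.natDegree_pow, Polynomial.natDegree_X_sub_C, Polynomial.natDegree_X_sub_C] at this
    have h2 := phi_natDegree w _ le_rfl 0
    omega
  have three : ∀ (w : MvPolynomial (Fin 2) ℂ) (r : ℂ), (phi w).coeff 0 ≠ 0 →
      (Polynomial.X - Polynomial.C r) ^ 3 ∣ (phi w).coeff 0 → 3 ≤ w.totalDegree := by
    intro w r hw h0
    have := Polynomial.natDegree_le_of_dvd h0 hw
    rw [Polynomial.natDegree_pow, Polynomial.natDegree_X_sub_C] at this
    have h2 := phi_natDegree w _ le_rfl 0
    omega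
  have hne : (phi u).coeff 0 * (phi v).coeff 0 ≠ 0 := by rw [e0]; exact pow_ne_zero 3 F0_ne
  have hu0 := left_ne_zero_of_mul hne
  have hv0 := right_ne_zero_of_mul hne
  have hsq := tt_sq
  have C3 : (Polynomial.C (1/9) : Polynomial ℂ) * 9 = 1 := by
    rw [← map_ofNat Polynomial.C 9, ← Polynomial.C_mul]; norm_num
  have s0 := local_split 0 _ ((phi u).coeff 1) ((phi u).coeff 2) _ ((phi v).coeff 1)
    ((phi v).coeff 2) (Polynomial.C (1/9) ^ 3 * (1 - Polynomial.X) ^ 3)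
    (3 * Polynomial.C (1/9) ^ 2 * (1 - Polynomial.X) ^ 2 * F1) (by norm_num)
    (by rw [e0, F0, Polynomial.C_0]; ring) (by rw [e1, F0, Polynomial.C_0]; ring) (by
      rw [e2]; simp [F0, H0]
      intro h
      have h' : tt = 9 / 4 := by linear_combination (-3) * h
      rw [h'] at hsq; norm_num at hsq)
  have s1 := local_split 1 _ ((phi u).coeff 1) ((phi u).coeff 2) _ ((phi v).coeff 1)
    ((phi v).coeff 2) (-Polynomial.C (1/9) ^ 3 * Polynomial.X ^ 3)
    (3 * Polynomial.C (1/9) ^ 2 * Polynomial.X ^ 2 * F1) (by norm_num)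
    (by rw [e0, F0, Polynomial.C_1]; ring) (by rw [e1, F0, Polynomial.C_1]; ring) (by
      rw [e2]; simp [F0, H0]
      intro h
      have h' : tt = -9 / 4 := by linear_combination 3 * h
      rw [h'] at hsq; norm_num at hsq)
  -- mixed case
  have mixed : ∀ u v : MvPolynomial (Fin 2) ℂ, u.totalDegree ≤ 3 → v.totalDegree ≤ 3 →
      (phi u).coeff 0 * (phi v).coeff 0 = F0 ^ 3 →
      (phi u).coeff 0 * (phi v).coeff 1 + (phi u).coeff 1 * (phi v).coeff 0 = 3 * F0 ^ 2 * F1 →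
      (phi u).coeff 0 * (phi v).coeff 2 + (phi u).coeff 1 * (phi v).coeff 1
        + (phi u).coeff 2 * (phi v).coeff 0 = 3 * F0 ^ 2 * F2 + 3 * F0 * F1 ^ 2 + H0 →
      (Polynomial.X - Polynomial.C (0:ℂ)) ^ 3 ∣ (phi u).coeff 0 →
      (Polynomial.X - Polynomial.C (1:ℂ)) ^ 3 ∣ (phi v).coeff 0 → False := by
    clear hg hu hv hdeg hphi e0 e1 e2 big three hne hu0 hv0 s0 s1
    intro u v du dv e0 e1 e2 d0 d1
    have du1 := phi_natDegree u 3 du 1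
    have du2 := phi_natDegree u 3 du 2
    have dv1 := phi_natDegree v 3 dv 1
    have dv2 := phi_natDegree v 3 dv 2
    generalize (phi u).coeff 0 = U0 at *
    generalize (phi u).coeff 1 = U1 at *
    generalize (phi u).coeff 2 = U2 at *
    generalize (phi v).coeff 0 = V0 at *
    generalize (phi v).coeff 1 = V1 at *
    generalize (phi v).coeff 2 = V2 at *
    obtain ⟨a, rfl⟩ := d0
    obtain ⟨b, rfl⟩ := d1
    have hab : a * b = Polynomial.C (-1/729) := by
      apply mul_left_cancel₀ (mul_ne_zero (pow_ne_zero 3 (Polynomial.X_sub_C_ne_zero (0:ℂ)))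
        (pow_ne_zero 3 (Polynomial.X_sub_C_ne_zero (1:ℂ))))
      have : (Polynomial.C (-1/729) : Polynomial ℂ) = - Polynomial.C (1/9) ^ 3 := by
        rw [← Polynomial.C_pow, ← Polynomial.C_neg]; norm_num
      rw [this]
      rw [F0] at e0
      simp only [Polynomial.C_0, Polynomial.C_1] at e0 ⊢
      linear_combination e0
    have hunit : IsUnit (a * b) := by
      rw [hab]; exact Polynomial.isUnit_C.2 (by norm_num)
    obtain ⟨α, -, rfl⟩ := Polynomial.isUnit_iff.1 (isUnit_of_mul_isUnit_left hunit)
    obtain ⟨β, -, rfl⟩ := Polynomial.isUnit_iff.1 (isUnit_of_mul_isUnit_right hunit)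
    rw [← Polynomial.C_mul] at hab
    have hab := Polynomial.C_injective hab
    obtain ⟨a0, a1, a2, rfl⟩ := quad_form U1 du1
    obtain ⟨b0, b1, b2, rfl⟩ := quad_form V1 dv1
    obtain ⟨u0, u1, rfl⟩ := lin_form U2 du2
    obtain ⟨v0, v1, rfl⟩ := lin_form V2 dv2
    refine no_cubics α β a0 a1 a2 b0 b1 b2 u0 u1 v0 v1 hab (fun z => ?_) (fun z => ?_)
    · have := congrArg (Polynomial.eval z) e1
      simp [F0, F1] at this
      linear_combination this
    · have := congrArg (Polynomial.eval z) e2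
      simp [F0, F1, F2, H0] at this
      linear_combination this
  rcases s0 with s0 | s0 <;> rcases s1 with s1 | s1
  · right
    have := big u hu0 s0 s1
    exact unit_of v hv (by omega)
  · exfalso
    have h1 := three u 0 hu0 s0
    have h2 := three v 1 hv0 s1
    exact mixed u v (by omega) (by omega) e0 e1 e2 s0 s1
  · exfalso
    have h1 := three v 0 hv0 s0
    have h2 := three u 1 hu0 s1
    exact mixed v u (by omega) (by omega) (by linear_combination e0) (by linear_combination e1)
      (by linear_combination e2) s0 s1
  · left
    have := big v hv0 s0 s1
    exact unit_of u hu (by omega)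

lemma g_irred : Irreducible g := by
  refine ⟨?_, fun u v h => phi_key u v h⟩
  intro hu
  obtain ⟨v, hv⟩ := hu.exists_right_inv
  have h0 : (phi g).coeff 0 * (phi v).coeff 0 = 1 := by
    rw [← Polynomial.mul_coeff_zero, ← map_mul, hv, map_one, Polynomial.coeff_one_zero]
  rw [phi_g0] at h0
  have := congrArg (Polynomial.eval 0) h0
  simp [F0] at this

/-- `g` is irreducible and of non-torus type. -/
theorem g_irreducible_and_non_torus :
    Irreducible g ∧
      ¬ ∃ p q : MvPolynomial (Fin 2) ℂ,
        p.totalDegree ≤ 2 ∧ q.totalDegree ≤ 3 ∧ g = p ^ 3 + q ^ 2 := by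
  exact ⟨g_irred, nontorus⟩

end
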